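/- arXiv:math/0611226 — 2 statements merged into one kernel-verified Lean document; each statement's English description precedes it below -/
import Mathlib

section
/- Let k be a commutative ring, R a commutative k-algebra, and L a Lie algebra over k which is simultaneously an R-module, and assume L is a faithful R-module (if f • Z = 0 for all Z in L then f = 0). Let a : L → Der_k(R) be a map into the k-linear derivations of R satisfying the Leibniz rule [X, f • Y] = f • [X, Y] + (a(X)(f)) • Y for all X, Y in L and f in R. Then a preserves brackets: for all X, Y in L, a([X, Y]) = a(X) ∘ a(Y) − a(Y) ∘ a(X), the commutator of the derivations a(X) and a(Y). -/
/-- Lie–Rinehart formulation: if `L` is a Lie algebra over `k`, a faithful `R`-module,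
and `a : L → Der_k(R)` satisfies the Leibniz rule, then `a` preserves brackets. -/
theorem anchor_preserves_brackets
    (k R L : Type*) [CommRing k] [CommRing R] [Algebra k R]
    [LieRing L] [LieAlgebra k L] [Module R L]
    (a : L → Derivation k R R)
    (hfaithful : ∀ f : R, (∀ Z : L, f • Z = 0) → f = 0)
    (hleibniz : ∀ (X Y : L) (f : R), ⁅X, f • Y⁆ = f • ⁅X, Y⁆ + (a X f) • Y) :
    ∀ (X Y : L) (f : R), a ⁅X, Y⁆ f = a X (a Y f) - a Y (a X f) := by
  intro X Y f
  rw [← sub_eq_zero]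
  refine hfaithful _ fun Z => ?_
  have h := lie_lie X Y (f • Z)
  simp only [hleibniz, lie_add, lie_lie, smul_sub] at h
  simp only [sub_smul]
  rw [← sub_eq_zero] at h
  refine Eq.trans ?_ h
  abel
end

section
/- Let p : K̂ → K be a central extension of groups (p surjective with kernel Z contained in the center of K̂). Let X be a set, {U_i}_{i∈I} a family of subsets of X, and let g_{ij} : U_i ∩ U_j → K be functions satisfying the cocycle identity g_{ij}(x)·g_{jk}(x) = g_{ik}(x) for all x ∈ U_i ∩ U_j ∩ U_k. Let ĝ_{ij} : U_i ∩ U_j → K̂ be lifts of the g_{ij} (p ∘ ĝ_{ij} = g_{ij}) and set h_{ijk} := ĝ_{ij}·ĝ_{jk}·ĝ_{ik}⁻¹. Then the following are equivalent: (1) there exists a family of lifts g̃_{ij} : U_i ∩ U_j → K̂ with p ∘ g̃_{ij} = g_{ij} which itself satisfies the cocycle identity g̃_{ij}(x)·g̃_{jk}(x) = g̃_{ik}(x) on all triple intersections; (2) the Z-valued 2-cocycle h is a Čech coboundary, i.e. there exist functions z_{ij} : U_i ∩ U_j → Z with h_{ijk}(x) = z_{ik}(x)·z_{jk}(x)⁻¹·z_{ij}(x)⁻¹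 for all x ∈ U_i ∩ U_j ∩ U_k. -/
/-- Correcting `a`, `b`, `c` by central elements `u`, `v`, `w` turns the defect `a * b * c⁻¹`
into a coboundary condition. -/
theorem mul_mul_eq_mul_iff_of_mem_center {G : Type*} [Group G] {a b c u v w : G}
    (hu : u ∈ Subgroup.center G) (hv : v ∈ Subgroup.center G) (hw : w ∈ Subgroup.center G) :
    (a * u) * (b * v) = c * w ↔ a * b * c⁻¹ = w * v⁻¹ * u⁻¹ := by
  have hvu := mul_mem (inv_mem hv) (inv_mem hu)
  rw [Subgroup.mem_center_iff] at hu hw hvu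
  have hl : (a * u) * (b * v) = a * b * (u * v) := by
    rw [mul_assoc a u, ← mul_assoc u b v, ← hu b]
    simp only [mul_assoc]
  rw [hl, ← eq_mul_inv_iff_mul_eq, mul_inv_eq_iff_eq_mul, mul_inv_rev, hw c,
    mul_assoc w c, hvu c]
  simp only [mul_assoc]

/-- For a central extension `p : Khat → K` with kernel `Z` and a `K`-valued Čech
1-cocycle `gᵢⱼ` with lifts `ghatᵢⱼ` and default `hᵢⱼₖ = ghatᵢⱼ ghatⱼₖ ghatᵢₖ⁻¹`: there exists a
family of lifts of `g` which is itself a cocycle if and only if `h` is a `Z`-valued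
Čech coboundary. -/
theorem exists_lifting_cocycle_iff_coboundary
    (Khat K : Type*) [Group Khat] [Group K]
    (p : Khat →* K) (hsurj : Function.Surjective p)
    (hcentral : p.ker ≤ Subgroup.center Khat)
    (X : Type*) (I : Type*) (U : I → Set X)
    (g : I → I → X → K)
    (hcocycle : ∀ (i j k : I) (x : X), x ∈ U i ∩ U j ∩ U k →
      g i j x * g j k x = g i k x)
    (ghat : I → I → X → Khat)
    (hlift : ∀ (i j : I) (x : X), x ∈ U i ∩ U j → p (ghat i j x) = g i j x)
    (h : I → I → I → X → Khat)
    (hdef : ∀ (i j k : I) (x : X), h i j k x = ghat i j x * ghat j k x * (ghat i k x)⁻¹) :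
    (∃ gtil : I → I → X → Khat,
      (∀ (i j : I) (x : X), x ∈ U i ∩ U j → p (gtil i j x) = g i j x) ∧
      (∀ (i j k : I) (x : X), x ∈ U i ∩ U j ∩ U k →
        gtil i j x * gtil j k x = gtil i k x)) ↔
    (∃ z : I → I → X → Khat,
      (∀ (i j : I) (x : X), x ∈ U i ∩ U j → z i j x ∈ p.ker) ∧
      (∀ (i j k : I) (x : X), x ∈ U i ∩ U j ∩ U k →
        h i j k x = z i k x * (z j k x)⁻¹ * (z i j x)⁻¹)) := by
  constructor
  · rintro ⟨gtil, hg, hc⟩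
    have hz : ∀ i j x, x ∈ U i ∩ U j → (ghat i j x)⁻¹ * gtil i j x ∈ p.ker := by
      intro i j x hx
      rw [MonoidHom.mem_ker, map_mul, map_inv, hlift i j x hx, hg i j x hx, inv_mul_cancel]
    refine ⟨fun i j x => (ghat i j x)⁻¹ * gtil i j x, hz, fun i j k x hx => ?_⟩
    rw [hdef, ← mul_mul_eq_mul_iff_of_mem_center (hcentral (hz i j x hx.1))
      (hcentral (hz j k x ⟨hx.1.2, hx.2⟩)) (hcentral (hz i k x ⟨hx.1.1, hx.2⟩))]
    simpa only [mul_inv_cancel_left] using hc i j k x hx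
  · rintro ⟨z, hz, hc⟩
    refine ⟨fun i j x => ghat i j x * z i j x, fun i j x hx => ?_, fun i j k x hx => ?_⟩
    · rw [map_mul, hlift i j x hx, MonoidHom.mem_ker.mp (hz i j x hx), mul_one]
    · rw [mul_mul_eq_mul_iff_of_mem_center (hcentral (hz i j x hx.1))
        (hcentral (hz j k x ⟨hx.1.2, hx.2⟩)) (hcentral (hz i k x ⟨hx.1.1, hx.2⟩)), ← hdef]
      exact hc i j k x hx
end
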